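/- arXiv:2007.12753 — 3 statements merged into one kernel-verified Lean document; each statement's English description precedes it below -/
import Mathlib

section
/- Let $\lambda \ge 1$ and let $f_1, f_2, f_3 : [0,1] \to \mathbb{C}$ be bounded measurable functions. Define $T_\lambda(f_1,f_2,f_3) = \int_{[0,1]^3} e^{i\lambda x_2(x_1+x_3)} f_1(x_1) f_2(x_2) f_3(x_3)\, dx_1\,dx_2\,dx_3$. Then there is an absolute constant $C$ such that $|T_\lambda(f_1,f_2,f_3)| \le C \lambda^{-1} \|f_1\|_{L^2} \|f_2\|_{L^\infty} \|f_3\|_{L^2}$. -/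
open MeasureTheory

/-- The Lebesgue measure restricted to the unit interval. -/
noncomputable def unitMeasure : Measure ℝ := volume.restrict (Set.Icc 0 1)

open scoped FourierTransform ContDiff ENNReal

/-- The Fourier integral of an integrable, square integrable function represents its
`L²` Fourier transform. -/
theorem fourier_ae_eq_fourier_toLp {f : ℝ → ℂ} (hf : Integrable f) (hf2 : MemLp f 2) :
    𝓕 f =ᵐ[volume] (𝓕 (hf2.toLp f) : Lp ℂ 2 (volume : Measure ℝ)) := by
  have hcont : Continuous (𝓕 f) :=
    VectorFourier.fourierIntegral_continuous Real.continuous_fourierChar continuous_inner hf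
  refine ae_eq_of_integral_contDiff_smul_eq hcont.locallyIntegrable
    ((Lp.memLp _).locallyIntegrable (by norm_num)) fun g g_smooth g_cpt => ?_
  have hg₁ : HasCompactSupport (Complex.ofRealCLM ∘ g) := g_cpt.comp_left rfl
  have hg₂ : ContDiff ℝ ∞ (Complex.ofRealCLM ∘ g) := by fun_prop
  set φ := hg₁.toSchwartzMap hg₂ with hφ
  have hφ_apply : ∀ x, φ x = (g x : ℂ) := fun x => by simp [hφ]
  have key := congrArg (fun T => T φ) (Lp.fourier_toTemperedDistribution_eq (hf2.toLp f))
  simp only [TemperedDistribution.fourier_apply, Lp.toTemperedDistribution_apply] at key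
  have hflip : ∫ x, 𝓕 (φ : ℝ → ℂ) x • f x = ∫ x, φ x • 𝓕 f x := by
    simpa using! VectorFourier.integral_fourierIntegral_smul_eq_flip (L := innerₗ ℝ)
      Real.continuous_fourierChar continuous_inner φ.integrable hf
  have hcoe : ∫ x, (𝓕 φ) x • (hf2.toLp f) x = ∫ x, 𝓕 (φ : ℝ → ℂ) x • f x := by
    refine integral_congr_ae ?_
    filter_upwards [hf2.coeFn_toLp] with x hx
    rw [hx, SchwartzMap.fourier_coe]
  calc ∫ x, g x • 𝓕 f x = ∫ x, φ x • 𝓕 f x := by simp [hφ_apply]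
    _ = ∫ x, φ x • (𝓕 (hf2.toLp f) : Lp ℂ 2 (volume : Measure ℝ)) x := by
      rw [← hflip, ← hcoe, key]
    _ = _ := by simp [hφ_apply]

/-- Plancherel's identity for functions in `L¹ ∩ L²`. -/
theorem eLpNorm_fourier_eq {f : ℝ → ℂ} (hf : Integrable f) (hf2 : MemLp f 2) :
    eLpNorm (𝓕 f) 2 = eLpNorm f 2 := by
  rw [eLpNorm_congr_ae (fourier_ae_eq_fourier_toLp hf hf2),
    ← eLpNorm_congr_ae hf2.coeFn_toLp, ← Lp.enorm_def, ← Lp.enorm_def,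
    ← ofReal_norm, ← ofReal_norm, Lp.norm_fourier_eq]

/-- The operator with kernel `exp (i * lam * y * x)` on the unit interval. -/
noncomputable def oscTransform (lam : ℝ) (f : ℝ → ℂ) (y : ℝ) : ℂ :=
  ∫ x in Set.Icc (0 : ℝ) 1, Complex.exp (Complex.I * (lam : ℂ) * ((y * x : ℝ) : ℂ)) * f x

theorem oscTransform_eq_fourier (lam : ℝ) (f : ℝ → ℂ) :
    oscTransform lam f =
      𝓕 ((Set.Icc (0 : ℝ) 1).indicator f) ∘ ((-lam / (2 * Real.pi)) * ·) := by
  ext y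
  rw [Function.comp_apply, Real.fourier_real_eq_integral_exp_smul, oscTransform,
    ← integral_indicator measurableSet_Icc]
  congr 1
  ext x
  by_cases hx : x ∈ Set.Icc (0 : ℝ) 1
  · rw [Set.indicator_of_mem hx, Set.indicator_of_mem hx, smul_eq_mul]
    congr 2
    have : -2 * Real.pi * x * (-lam / (2 * Real.pi) * y) = lam * (y * x) := by
      field_simp
    rw [this]
    push_cast
    ring
  · simp [Set.indicator_of_notMem hx]

theorem memLp_indicator_Icc {f : ℝ → ℂ} (hf : Measurable f) (hb : ∃ M : ℝ, ∀ x, ‖f x‖ ≤ M)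
    (p : ℝ≥0∞) : MemLp ((Set.Icc (0 : ℝ) 1).indicator f) p := by
  obtain ⟨M, hM⟩ := hb
  rw [memLp_indicator_iff_restrict measurableSet_Icc]
  exact MemLp.of_bound hf.aestronglyMeasurable M (.of_forall hM)

theorem continuous_oscTransform (lam : ℝ) {f : ℝ → ℂ} (hf : Measurable f)
    (hb : ∃ M : ℝ, ∀ x, ‖f x‖ ≤ M) : Continuous (oscTransform lam f) := by
  rw [oscTransform_eq_fourier]
  exact (VectorFourier.fourierIntegral_continuous Real.continuous_fourierChar continuous_inner
    (memLp_one_iff_integrable.1 (memLp_indicator_Icc hf hb 1))).comp (by fun_prop)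

/-- The `L²` bound for the bilinear oscillatory form with phase `lam * x * y`. -/
theorem eLpNorm_oscTransform_le {lam : ℝ} (hlam : 0 < lam) {f : ℝ → ℂ} (hf : Measurable f)
    (hb : ∃ M : ℝ, ∀ x, ‖f x‖ ≤ M) :
    eLpNorm (oscTransform lam f) 2 unitMeasure ≤
      ENNReal.ofReal (2 * Real.pi / lam) ^ (1 / 2 : ℝ) * eLpNorm f 2 unitMeasure := by
  have hint := memLp_one_iff_integrable.1 (memLp_indicator_Icc hf hb 1)
  have hcont : Continuous (𝓕 ((Set.Icc (0 : ℝ) 1).indicator f)) :=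
    VectorFourier.fourierIntegral_continuous Real.continuous_fourierChar continuous_inner hint
  have hne : -lam / (2 * Real.pi) ≠ 0 := div_ne_zero (by linarith) (by positivity)
  have habs : |(-lam / (2 * Real.pi))⁻¹| = 2 * Real.pi / lam := by
    rw [inv_div, div_neg, abs_neg, abs_of_pos (by positivity)]
  calc eLpNorm (oscTransform lam f) 2 unitMeasure
      ≤ eLpNorm (oscTransform lam f) 2 volume := eLpNorm_mono_measure _ Measure.restrict_le_self
    _ = ENNReal.ofReal (2 * Real.pi / lam) ^ (1 / 2 : ℝ) *
        eLpNorm (𝓕 ((Set.Icc (0 : ℝ) 1).indicator f)) 2 := by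
      rw [oscTransform_eq_fourier, ← eLpNorm_map_measure hcont.aestronglyMeasurable
        (by fun_prop), Real.map_volume_mul_left hne, habs,
        eLpNorm_smul_measure_of_ne_top (by norm_num)]
      simp
    _ = _ := by
      rw [eLpNorm_fourier_eq hint (memLp_indicator_Icc hf hb 2),
        eLpNorm_indicator_eq_eLpNorm_restrict measurableSet_Icc, unitMeasure]

/-- The trilinear form factors through two oscillatory transforms. -/
theorem trilinear_eq_integral_oscTransform (lam : ℝ) {f₁ f₂ f₃ : ℝ → ℂ} (h₁ : Measurable f₁)
    (h₂ : Measurable f₂) (h₃ : Measurable f₃) (b₁ : ∃ M : ℝ, ∀ x, ‖f₁ x‖ ≤ M)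
    (b₂ : ∃ M : ℝ, ∀ x, ‖f₂ x‖ ≤ M) (b₃ : ∃ M : ℝ, ∀ x, ‖f₃ x‖ ≤ M) :
    (∫ x₁ in Set.Icc (0:ℝ) 1, ∫ x₂ in Set.Icc (0:ℝ) 1, ∫ x₃ in Set.Icc (0:ℝ) 1,
        Complex.exp (Complex.I * (lam : ℂ) * ((x₂ * (x₁ + x₃) : ℝ) : ℂ)) *
          f₁ x₁ * f₂ x₂ * f₃ x₃) =
      ∫ y in Set.Icc (0 : ℝ) 1, f₂ y * (oscTransform lam f₁ y * oscTransform lam f₃ y) := by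
  have hinner : ∀ x y : ℝ, (∫ z in Set.Icc (0:ℝ) 1,
        Complex.exp (Complex.I * (lam : ℂ) * ((y * (x + z) : ℝ) : ℂ)) * f₁ x * f₂ y * f₃ z) =
      (Complex.exp (Complex.I * (lam : ℂ) * ((y * x : ℝ) : ℂ)) * f₁ x) *
        (f₂ y * oscTransform lam f₃ y) := fun x y => by
    rw [oscTransform, ← integral_const_mul, ← integral_const_mul]
    congr 1
    ext z
    have : Complex.I * (lam : ℂ) * ((y * (x + z) : ℝ) : ℂ) =
        Complex.I * (lam : ℂ) * ((y * x : ℝ) : ℂ) +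
          Complex.I * (lam : ℂ) * ((y * z : ℝ) : ℂ) := by
      push_cast
      ring
    rw [this, Complex.exp_add]
    ring
  simp_rw [hinner]
  rw [integral_integral_swap]
  · congr 1
    ext y
    rw [integral_mul_const, ← oscTransform]
    ring
  · have hc := continuous_oscTransform lam h₃ b₃
    obtain ⟨M₁, hM₁⟩ := b₁
    obtain ⟨M₂, hM₂⟩ := b₂
    obtain ⟨M₃, hM₃⟩ := isCompact_Icc.exists_bound_of_continuousOn
      (s := Set.Icc (0 : ℝ) 1) hc.continuousOn
    have hM₁0 : 0 ≤ M₁ := (norm_nonneg _).trans (hM₁ 0)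
    have hM₂0 : 0 ≤ M₂ := (norm_nonneg _).trans (hM₂ 0)
    refine Integrable.of_bound (C := M₁ * (M₂ * M₃)) ?_ ?_
    · refine Measurable.aestronglyMeasurable ?_
      have := hc.measurable
      simp only [Function.uncurry_def]
      fun_prop
    · rw [Measure.prod_restrict]
      refine (ae_restrict_mem (measurableSet_Icc.prod measurableSet_Icc)).mono ?_
      rintro ⟨x, y⟩ ⟨-, hy⟩
      have hexp : ‖Complex.exp (Complex.I * (lam : ℂ) * ((y * x : ℝ) : ℂ))‖ = 1 := by
        rw [mul_assoc, ← Complex.ofReal_mul, Complex.norm_exp_I_mul_ofReal]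
      simp only [Function.uncurry_apply_pair, norm_mul, hexp, one_mul]
      gcongr
      exacts [hM₁ x, hM₂ y, hM₃ y hy]

theorem stmt3 :
    ∃ C : ℝ, 0 < C ∧ ∀ (lam : ℝ), 1 ≤ lam →
      ∀ (f₁ f₂ f₃ : ℝ → ℂ), Measurable f₁ → Measurable f₂ → Measurable f₃ →
      (∃ M : ℝ, ∀ x, ‖f₁ x‖ ≤ M) → (∃ M : ℝ, ∀ x, ‖f₂ x‖ ≤ M) →
      (∃ M : ℝ, ∀ x, ‖f₃ x‖ ≤ M) →
      ‖∫ x₁ in Set.Icc (0:ℝ) 1, ∫ x₂ in Set.Icc (0:ℝ) 1, ∫ x₃ in Set.Icc (0:ℝ) 1,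
          Complex.exp (Complex.I * (lam : ℂ) * ((x₂ * (x₁ + x₃) : ℝ) : ℂ)) *
            f₁ x₁ * f₂ x₂ * f₃ x₃‖ ≤
        C * lam⁻¹ * (eLpNorm f₁ 2 unitMeasure).toReal *
          (eLpNorm f₂ ⊤ unitMeasure).toReal * (eLpNorm f₃ 2 unitMeasure).toReal := by
  refine ⟨2 * Real.pi, by positivity, fun lam hlam f₁ f₂ f₃ h₁ h₂ h₃ b₁ b₂ b₃ => ?_⟩
  have hpos : 0 < lam := by linarith
  rw [trilinear_eq_integral_oscTransform lam h₁ h₂ h₃ b₁ b₂ b₃]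
  have hfin : ∀ {f : ℝ → ℂ} (p : ℝ≥0∞), Measurable f → (∃ M : ℝ, ∀ x, ‖f x‖ ≤ M) →
      eLpNorm f p unitMeasure ≠ ⊤ := fun {f} p hf hb => by
    rw [unitMeasure, ← eLpNorm_indicator_eq_eLpNorm_restrict measurableSet_Icc]
    exact (memLp_indicator_Icc hf hb p).eLpNorm_ne_top
  have hG₁ := (continuous_oscTransform lam h₁ b₁).aestronglyMeasurable (μ := unitMeasure)
  have hG₃ := (continuous_oscTransform lam h₃ b₃).aestronglyMeasurable (μ := unitMeasure)
  set c := ENNReal.ofReal (2 * Real.pi / lam) with hc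
  have hcc : c ^ (1 / 2 : ℝ) * c ^ (1 / 2 : ℝ) = c := by
    rw [← ENNReal.rpow_add_of_nonneg _ _ (by norm_num) (by norm_num)]
    norm_num
  have hle : ‖∫ y in Set.Icc (0 : ℝ) 1,
        f₂ y * (oscTransform lam f₁ y * oscTransform lam f₃ y)‖ₑ ≤
      c * eLpNorm f₁ 2 unitMeasure * eLpNorm f₂ ⊤ unitMeasure * eLpNorm f₃ 2 unitMeasure := by
    calc _ ≤ eLpNorm (f₂ • (oscTransform lam f₁ • oscTransform lam f₃)) 1 unitMeasure := by
          rw [eLpNorm_one_eq_lintegral_enorm]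
          exact enorm_integral_le_lintegral_enorm _
      _ ≤ eLpNorm f₂ ⊤ unitMeasure *
          eLpNorm (oscTransform lam f₁ • oscTransform lam f₃) 1 unitMeasure :=
        eLpNorm_smul_le_mul_eLpNorm (hG₁.smul hG₃) h₂.aestronglyMeasurable
      _ ≤ eLpNorm f₂ ⊤ unitMeasure * (eLpNorm (oscTransform lam f₁) 2 unitMeasure *
          eLpNorm (oscTransform lam f₃) 2 unitMeasure) := by
        gcongr
        exact eLpNorm_smul_le_mul_eLpNorm hG₃ hG₁
      _ ≤ eLpNorm f₂ ⊤ unitMeasure * ((c ^ (1 / 2 : ℝ) * eLpNorm f₁ 2 unitMeasure) *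
          (c ^ (1 / 2 : ℝ) * eLpNorm f₃ 2 unitMeasure)) := by
        gcongr
        exacts [eLpNorm_oscTransform_le hpos h₁ b₁, eLpNorm_oscTransform_le hpos h₃ b₃]
      _ = (c ^ (1 / 2 : ℝ) * c ^ (1 / 2 : ℝ)) * eLpNorm f₁ 2 unitMeasure *
          eLpNorm f₂ ⊤ unitMeasure * eLpNorm f₃ 2 unitMeasure := by ring
      _ = _ := by rw [hcc]
  have htop : c * eLpNorm f₁ 2 unitMeasure * eLpNorm f₂ ⊤ unitMeasure *
      eLpNorm f₃ 2 unitMeasure ≠ ⊤ :=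
    ENNReal.mul_ne_top (ENNReal.mul_ne_top (ENNReal.mul_ne_top ENNReal.ofReal_ne_top
      (hfin 2 h₁ b₁)) (hfin ⊤ h₂ b₂)) (hfin 2 h₃ b₃)
  have := ENNReal.toReal_mono htop hle
  rwa [toReal_enorm, ENNReal.toReal_mul, ENNReal.toReal_mul, ENNReal.toReal_mul, hc,
    ENNReal.toReal_ofReal (by positivity), div_eq_mul_inv] at this
end

section
/- Let $N \in \mathbb{N}$ and $C_1, C_2 \in (0,\infty)$. There exist $C < \infty$ and $\rho > 0$ with the following property: if $\psi \in C^{N+1}([0,1]^2)$ satisfies $\|\psi\|_{C^{N+1}} \le C_2$ and $\sum_{0 \le |\alpha| \le N} |\partial^\alpha \psi(x)| \ge C_1$ for every $x \in [0,1]^2$, then for every $\varepsilon > 0$, $|\{x \in [0,1]^2 : |\psi(x)| \le \varepsilon\}| \le C \varepsilon^{\rho}$. -/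
open MeasureTheory

/-- If two points of a subset of `[0,1]` at distance at most `r` are in fact at distance at most
`η`, then the set has measure at most `(⌊1 / r⌋₊ + 1) * η`. -/
theorem volume_le_of_dist_le_imp_dist_le {T : Set ℝ} (hT : T ⊆ Set.Icc 0 1) {r η : ℝ}
    (hr : 0 < r) (h : ∀ s ∈ T, ∀ t ∈ T, |s - t| ≤ r → |s - t| ≤ η) :
    volume T ≤ (⌊1 / r⌋₊ + 1 : ℕ) * ENNReal.ofReal η := by
  have hcover : T ⊆ ⋃ j ∈ Finset.range (⌊1 / r⌋₊ + 1), T ∩ Set.Icc (j * r) ((j + 1) * r) := by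
    intro t ht
    have ht' := hT ht
    have h0 : 0 ≤ t / r := div_nonneg ht'.1 hr.le
    simp only [Set.mem_iUnion, Finset.mem_range]
    refine ⟨⌊t / r⌋₊, ?_, ht, ?_, ?_⟩
    · exact Nat.lt_succ_of_le (Nat.floor_le_floor (by gcongr; exact ht'.2))
    · exact (le_div_iff₀ hr).1 (Nat.floor_le h0)
    · exact (div_le_iff₀ hr).1 (Nat.lt_floor_add_one _).le
  calc volume T ≤ _ := measure_mono hcover
    _ ≤ ∑ j ∈ Finset.range (⌊1 / r⌋₊ + 1), volume (T ∩ Set.Icc (j * r) ((j + 1) * r)) :=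
        measure_biUnion_finset_le _ _
    _ ≤ ∑ j ∈ Finset.range (⌊1 / r⌋₊ + 1), ENNReal.ofReal η := by
        refine Finset.sum_le_sum fun j _ => (Real.volume_le_diam _).trans ?_
        refine Metric.ediam_le fun s hs t ht => ?_
        rw [edist_dist, Real.dist_eq]
        refine ENNReal.ofReal_le_ofReal (h s hs.1 t ht.1 ?_)
        obtain ⟨-, hs1, hs2⟩ := hs
        obtain ⟨-, ht1, ht2⟩ := ht
        rw [abs_le]
        constructor <;> linarith
    _ = _ := by simp

/-- A measurable subset of the unit cube, all of whose slices in a coordinate direction have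
measure at most `M`, has measure at most `M`. -/
theorem volume_le_of_volume_slice_le {n : ℕ} {S : Set (Fin (n + 1) → ℝ)} (hS : MeasurableSet S)
    (hS1 : S ⊆ Set.Icc 0 1) (i : Fin (n + 1)) {M : ENNReal}
    (h : ∀ x, volume {t | Function.update x i t ∈ S} ≤ M) : volume S ≤ M := by
  have hp := (volume_preserving_piFinSuccAbove (fun _ : Fin (n + 1) => ℝ) i).symm
  rw [← hp.measure_preimage hS.nullMeasurableSet, Measure.volume_eq_prod,
    Measure.prod_apply_symm ((MeasurableEquiv.measurable _) hS)]
  calc _ ≤ ∫⁻ y : Fin n → ℝ, (Set.Icc 0 1).indicator (fun _ => M) y := by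
        refine lintegral_mono fun y => ?_
        by_cases hy : y ∈ Set.Icc (0 : Fin n → ℝ) 1
        · rw [Set.indicator_of_mem hy]
          refine le_of_eq_of_le ?_ (h (i.insertNth 0 y))
          congr 1
          ext t
          change i.insertNth t y ∈ S ↔ Function.update (i.insertNth 0 y) i t ∈ S
          rw [Fin.update_insertNth]
        · rw [Set.indicator_of_notMem hy, nonpos_iff_eq_zero]
          convert measure_empty (μ := (volume : Measure ℝ))
          refine Set.eq_empty_of_forall_notMem fun t ht => hy ?_
          have : (i.insertNth t y : Fin (n + 1) → ℝ) ∈ Set.Icc 0 1 := hS1 ht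
          exact ⟨fun j => by simpa using this.1 (i.succAbove j),
            fun j => by simpa using this.2 (i.succAbove j)⟩
    _ = M := by
        rw [lintegral_indicator_const measurableSet_Icc, Real.volume_Icc_pi]
        simp

/-- Quantitative expansion of a map with Lipschitz derivative along a direction in which the
derivative is large. -/
theorem abs_mul_le_norm_sub_of_le_norm_fderiv {E G : Type*} [NormedAddCommGroup E]
    [NormedSpace ℝ E] [NormedAddCommGroup G] [NormedSpace ℝ G] {F : E → G}
    (hF : Differentiable ℝ F) {s : Set E} (hs : Convex ℝ s) {K : ℝ} (hK : 0 < K)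
    (hlip : ∀ x ∈ s, ∀ y ∈ s, ‖fderiv ℝ F y - fderiv ℝ F x‖ ≤ K * ‖y - x‖) {δ : ℝ}
    {x e : E} (he : ‖e‖ ≤ 1) (hδ : δ / 2 ≤ ‖fderiv ℝ F x e‖) (hx : x ∈ s) {t : ℝ}
    (hy : x + t • e ∈ s) (ht : |t| ≤ δ / (4 * K)) :
    |t| * (δ / 4) ≤ ‖F (x + t • e) - F x‖ := by
  have hKt : K * |t| ≤ δ / 4 := by
    rw [le_div_iff₀ (by positivity)] at ht
    linarith
  have hdist : ‖t • e‖ ≤ |t| := by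
    rw [norm_smul, Real.norm_eq_abs]
    exact mul_le_of_le_one_right (abs_nonneg t) he
  have hseg := (convex_segment (𝕜 := ℝ) x (x + t • e)).norm_image_sub_le_of_norm_hasFDerivWithin_le'
    (f := F) (f' := fderiv ℝ F) (φ := fderiv ℝ F x) (C := δ / 4)
    (fun z _ => (hF z).hasFDerivAt.hasFDerivWithinAt) (fun z hz => ?_)
    (left_mem_segment ℝ _ _) (right_mem_segment ℝ _ _)
  · rw [add_sub_cancel_left, map_smul] at hseg
    have h0 : 0 ≤ δ / 4 := le_trans (by positivity) hKt
    have h1 : ‖t • fderiv ℝ F x e‖ = |t| * ‖fderiv ℝ F x e‖ := by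
      rw [norm_smul, Real.norm_eq_abs]
    have h2 := norm_sub_norm_le (t • fderiv ℝ F x e) (F (x + t • e) - F x)
    rw [norm_sub_rev (t • _)] at h2
    have h3 := mul_le_mul_of_nonneg_left hδ (abs_nonneg t)
    have h4 := mul_le_mul_of_nonneg_left hdist h0
    linarith
  · refine (hlip x hx z (hs.segment_subset hx hy hz)).trans (le_trans ?_ hKt)
    gcongr
    refine (norm_sub_le_of_mem_segment hz).trans ?_
    rwa [add_sub_cancel_left]

/-- A vector-valued map on the unit square is small with large derivative only on a small set. -/
theorem volume_norm_le_lt_norm_fderiv_le {G : Type*} [NormedAddCommGroup G] [NormedSpace ℝ G]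
    {F : (Fin 2 → ℝ) → G} (hF : ContDiff ℝ 1 F) {K : ℝ} (hK : 1 ≤ K)
    (hlip : ∀ x ∈ Set.Icc (0 : Fin 2 → ℝ) 1, ∀ y ∈ Set.Icc (0 : Fin 2 → ℝ) 1,
      ‖fderiv ℝ F y - fderiv ℝ F x‖ ≤ K * ‖y - x‖)
    {ε δ : ℝ} (hδ : 0 < δ) (hδ1 : δ ≤ 1) (hε : 0 < ε) :
    volume {x ∈ Set.Icc (0 : Fin 2 → ℝ) 1 | ‖F x‖ ≤ ε ∧ δ < ‖fderiv ℝ F x‖} ≤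
      ENNReal.ofReal (128 * K * (ε / δ ^ 2)) := by
  have hK0 : 0 < K := by linarith
  set S : Fin 2 → Set (Fin 2 → ℝ) := fun i =>
    {x ∈ Set.Icc (0 : Fin 2 → ℝ) 1 | ‖F x‖ ≤ ε ∧ δ / 2 ≤ ‖fderiv ℝ F x (Pi.single i 1)‖} with hSdef
  have hcont : Continuous (fderiv ℝ F) := hF.continuous_fderiv one_ne_zero
  have hSmeas : ∀ i, MeasurableSet (S i) := fun i =>
    (isClosed_Icc.inter ((isClosed_le hF.continuous.norm continuous_const).inter
      (isClosed_le continuous_const (hcont.clm_apply continuous_const).norm))).measurableSet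
  have hsub : {x ∈ Set.Icc (0 : Fin 2 → ℝ) 1 | ‖F x‖ ≤ ε ∧ δ < ‖fderiv ℝ F x‖} ⊆ S 0 ∪ S 1 := by
    rintro x ⟨hx, hx1, hx2⟩
    by_contra! hcon
    simp only [hSdef, Set.mem_union, Set.mem_ofPred_eq, hx, hx1, true_and, not_or, not_le] at hcon
    refine hx2.not_ge (ContinuousLinearMap.opNorm_le_bound _ hδ.le fun v => ?_)
    have hv : v = v 0 • Pi.single 0 1 + v 1 • Pi.single 1 1 := by
      ext j
      fin_cases j <;> simp
    have h0 := norm_le_pi_norm v 0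
    have h1 := norm_le_pi_norm v 1
    calc ‖fderiv ℝ F x v‖
        = ‖v 0 • fderiv ℝ F x (Pi.single 0 1) + v 1 • fderiv ℝ F x (Pi.single 1 1)‖ := by
          rw [← map_smul, ← map_smul, ← map_add, ← hv]
      _ ≤ ‖v 0‖ * ‖fderiv ℝ F x (Pi.single 0 1)‖ + ‖v 1‖ * ‖fderiv ℝ F x (Pi.single 1 1)‖ := by
          rw [← norm_smul, ← norm_smul]
          exact norm_add_le _ _
      _ ≤ ‖v‖ * (δ / 2) + ‖v‖ * (δ / 2) := by
          gcongr
          · exact hcon.1.le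
          · exact hcon.2.le
      _ = δ * ‖v‖ := by ring
  have hSvol : ∀ i, volume (S i) ≤ ENNReal.ofReal (64 * K * (ε / δ ^ 2)) := by
    intro i
    refine volume_le_of_volume_slice_le (hSmeas i) (fun x hx => hx.1) i fun x => ?_
    have hr : 0 < δ / (4 * K) := by positivity
    refine (volume_le_of_dist_le_imp_dist_le (r := δ / (4 * K)) (η := 8 * ε / δ)
      (fun t ht => ?_) hr fun s hs t ht hst => ?_).trans ?_
    · have := ht.1
      exact ⟨by simpa using this.1 i, by simpa using this.2 i⟩
    · have hupd : Function.update x i s =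
          Function.update x i t + (s - t) • (Pi.single i 1 : Fin 2 → ℝ) := by
        ext j
        rcases eq_or_ne j i with rfl | hj
        · simp
        · simp [hj]
      have hle := abs_mul_le_norm_sub_of_le_norm_fderiv (hF.differentiable one_ne_zero)
        (convex_Icc 0 1) hK0 hlip (e := Pi.single i 1) (by simp [Pi.norm_single]) ht.2.2 ht.1
        (hupd ▸ hs.1) hst
      rw [← hupd] at hle
      have h1 := norm_sub_le (F (Function.update x i s)) (F (Function.update x i t))
      have h2 := hs.2.1
      have h3 := ht.2.1
      rw [le_div_iff₀ hδ]
      linarith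
    · rw [← ENNReal.ofReal_natCast, ← ENNReal.ofReal_mul (by positivity)]
      refine ENNReal.ofReal_le_ofReal ?_
      have hfl : (⌊1 / (δ / (4 * K))⌋₊ : ℝ) ≤ 1 / (δ / (4 * K)) := Nat.floor_le (by positivity)
      have h1 : 1 ≤ 1 / (δ / (4 * K)) := by
        rw [one_le_div hr, div_le_one (by positivity)]
        linarith
      calc ((⌊1 / (δ / (4 * K))⌋₊ + 1 : ℕ) : ℝ) * (8 * ε / δ)
          ≤ (2 * (1 / (δ / (4 * K)))) * (8 * ε / δ) := by
            gcongr
            push_cast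
            linarith
        _ = 64 * K * (ε / δ ^ 2) := by
            field_simp
            ring
  calc _ ≤ volume (S 0 ∪ S 1) := measure_mono hsub
    _ ≤ volume (S 0) + volume (S 1) := measure_union_le _ _
    _ ≤ _ := add_le_add (hSvol 0) (hSvol 1)
    _ = _ := by
        rw [← ENNReal.ofReal_add (by positivity) (by positivity)]
        congr 1
        ring

/-- The set where a derivative of order `k` is small while the next one is large is small. -/
theorem volume_iteratedFDeriv_le {ψ : (Fin 2 → ℝ) → ℝ} {k : ℕ} (hψ : ContDiff ℝ (k + 2 : ℕ) ψ)
    {K : ℝ} (hK : 1 ≤ K)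
    (hbd : ∀ x ∈ Set.Icc (0 : Fin 2 → ℝ) 1, ‖iteratedFDeriv ℝ (k + 2) ψ x‖ ≤ K)
    {ε δ : ℝ} (hδ : 0 < δ) (hδ1 : δ ≤ 1) (hε : 0 < ε) :
    volume {x ∈ Set.Icc (0 : Fin 2 → ℝ) 1 |
        ‖iteratedFDeriv ℝ k ψ x‖ ≤ ε ∧ δ < ‖iteratedFDeriv ℝ (k + 1) ψ x‖} ≤
      ENNReal.ofReal (128 * K * (ε / δ ^ 2)) := by
  have hF : ContDiff ℝ 1 (iteratedFDeriv ℝ k ψ) :=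
    hψ.iteratedFDeriv_right (by norm_cast; omega)
  have hdiff : Differentiable ℝ (iteratedFDeriv ℝ (k + 1) ψ) :=
    hψ.differentiable_iteratedFDeriv (by norm_cast; omega)
  simp_rw [← norm_fderiv_iteratedFDeriv (n := k)]
  refine volume_norm_le_lt_norm_fderiv_le hF hK (fun x hx y hy => ?_) hδ hδ1 hε
  rw [fderiv_iteratedFDeriv]
  simp only [Function.comp_apply]
  rw [← dist_eq_norm, LinearIsometryEquiv.dist_map, dist_eq_norm]
  refine (convex_Icc (0 : Fin 2 → ℝ) 1).norm_image_sub_le_of_norm_fderiv_le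
    (fun z _ => hdiff z) (fun z hz => ?_) hx hy
  rw [norm_fderiv_iteratedFDeriv]
  exact hbd z hz

/-- Measure bound for the set where all derivatives of order at most `N - j` are small. -/
theorem volume_forall_iteratedFDeriv_le {N : ℕ} {C₁ K : ℝ} (hC₁ : 0 < C₁) (hK : 1 ≤ K)
    {ψ : (Fin 2 → ℝ) → ℝ} (hψ : ContDiff ℝ (N + 1 : ℕ) ψ)
    (hbd : ∀ x ∈ Set.Icc (0 : Fin 2 → ℝ) 1, ∀ k ≤ N + 1, ‖iteratedFDeriv ℝ k ψ x‖ ≤ K)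
    (hlow : ∀ x ∈ Set.Icc (0 : Fin 2 → ℝ) 1,
      C₁ ≤ ∑ k ∈ Finset.range (N + 1), ‖iteratedFDeriv ℝ k ψ x‖)
    (j : ℕ) {m : ℕ} (hjm : m + j = N) {ε : ℝ} (hε : 0 < ε) (hε1 : ε ≤ 1) :
    volume {x ∈ Set.Icc (0 : Fin 2 → ℝ) 1 | ∀ k ≤ m, ‖iteratedFDeriv ℝ k ψ x‖ ≤ ε} ≤
      ENNReal.ofReal (((N + 1) / C₁ + 128 * K * j) * ε ^ ((1 / 3 : ℝ) ^ j)) := by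
  have hK0 : 0 < K := by linarith
  induction j generalizing m ε with
  | zero =>
    obtain rfl : m = N := by omega
    rcases Set.eq_empty_or_nonempty
      {x ∈ Set.Icc (0 : Fin 2 → ℝ) 1 | ∀ k ≤ m, ‖iteratedFDeriv ℝ k ψ x‖ ≤ ε} with he | ⟨x, hx, hxk⟩
    · rw [he]
      simp
    · have hsum : C₁ ≤ (m + 1) * ε := by
        refine (hlow x hx).trans ((Finset.sum_le_card_nsmul _ _ ε fun k hk =>
          hxk k (Nat.lt_succ_iff.1 (Finset.mem_range.1 hk))).trans_eq ?_)
        simp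
      refine (measure_mono (t := Set.Icc (0 : Fin 2 → ℝ) 1) fun y hy => hy.1).trans ?_
      rw [Real.volume_Icc_pi]
      simp only [Pi.one_apply, Pi.zero_apply, sub_zero, ENNReal.ofReal_one, Finset.prod_const_one,
        pow_zero, Real.rpow_one, Nat.cast_zero, mul_zero, add_zero, ENNReal.one_le_ofReal]
      rwa [div_mul_eq_mul_div, one_le_div hC₁]
  | succ j ih =>
    set δ : ℝ := ε ^ (1 / 3 : ℝ) with hδdef
    have hδ : 0 < δ := Real.rpow_pos_of_pos hε _
    have hδ1 : δ ≤ 1 := Real.rpow_le_one hε.le hε1 (by norm_num)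
    have hδ3 : δ ^ 3 = ε := by
      rw [hδdef, ← Real.rpow_natCast, ← Real.rpow_mul hε.le]
      norm_num
    have hεδ : ε ≤ δ := by
      rw [← hδ3]
      exact pow_le_of_le_one hδ.le hδ1 (by norm_num)
    have hpow : δ ^ ((1 / 3 : ℝ) ^ j) = ε ^ ((1 / 3 : ℝ) ^ (j + 1)) := by
      rw [hδdef, ← Real.rpow_mul hε.le, pow_succ']
    have hquot : ε / δ ^ 2 = δ := by
      rw [← hδ3]
      field_simp
    have hδle : δ ≤ ε ^ ((1 / 3 : ℝ) ^ (j + 1)) :=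
      Real.rpow_le_rpow_of_exponent_ge hε hε1
        (pow_le_of_le_one (by norm_num) (by norm_num) (by omega))
    have hstep := volume_iteratedFDeriv_le (k := m) (hψ.of_le (by norm_cast; omega)) hK
      (fun x hx => hbd x hx (m + 2) (by omega)) hδ hδ1 hε
    have hih := ih (m := m + 1) (by omega) hδ hδ1
    rw [hquot] at hstep
    rw [hpow] at hih
    have hsub : {x ∈ Set.Icc (0 : Fin 2 → ℝ) 1 | ∀ k ≤ m, ‖iteratedFDeriv ℝ k ψ x‖ ≤ ε} ⊆
        {x ∈ Set.Icc (0 : Fin 2 → ℝ) 1 | ∀ k ≤ m + 1, ‖iteratedFDeriv ℝ k ψ x‖ ≤ δ} ∪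
        {x ∈ Set.Icc (0 : Fin 2 → ℝ) 1 |
          ‖iteratedFDeriv ℝ m ψ x‖ ≤ ε ∧ δ < ‖iteratedFDeriv ℝ (m + 1) ψ x‖} := by
      rintro x ⟨hx, hxk⟩
      rcases le_or_gt ‖iteratedFDeriv ℝ (m + 1) ψ x‖ δ with h | h
      · refine Or.inl ⟨hx, fun k hk => ?_⟩
        rcases Nat.le_succ_iff.1 hk with hk | rfl
        · exact (hxk k hk).trans hεδ
        · exact h
      · exact Or.inr ⟨hx, hxk m le_rfl, h⟩
    refine (measure_mono hsub).trans ((measure_union_le _ _).trans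
      ((add_le_add hih hstep).trans ?_))
    rw [← ENNReal.ofReal_add (by positivity) (by positivity)]
    refine ENNReal.ofReal_le_ofReal ?_
    have := mul_le_mul_of_nonneg_left hδle (by positivity : 0 ≤ 128 * K)
    push_cast
    linarith

theorem stmt9 (N : ℕ) (C₁ C₂ : ℝ) (hC₁ : 0 < C₁) (hC₂ : 0 < C₂) :
    ∃ C ρ : ℝ, 0 < C ∧ 0 < ρ ∧
      ∀ ψ : (Fin 2 → ℝ) → ℝ, ContDiff ℝ (N + 1) ψ →
      (∀ x ∈ Set.Icc (0 : Fin 2 → ℝ) 1, ∀ k ≤ N + 1, ‖iteratedFDeriv ℝ k ψ x‖ ≤ C₂) →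
      (∀ x ∈ Set.Icc (0 : Fin 2 → ℝ) 1,
        C₁ ≤ ∑ k ∈ Finset.range (N + 1), ‖iteratedFDeriv ℝ k ψ x‖) →
      ∀ ε : ℝ, 0 < ε →
        volume {x ∈ Set.Icc (0 : Fin 2 → ℝ) 1 | |ψ x| ≤ ε} ≤
          ENNReal.ofReal (C * ε ^ ρ) := by
  refine ⟨(N + 1) / C₁ + 128 * (C₂ + 1) * N + 1, (1 / 3 : ℝ) ^ N, by positivity, by positivity,
    fun ψ hψ hbd hlow ε hε => ?_⟩
  rcases le_or_gt ε 1 with hε1 | hε1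
  · have hmain := volume_forall_iteratedFDeriv_le hC₁ (K := C₂ + 1) (by linarith)
      (by exact_mod_cast hψ) (fun x hx k hk => (hbd x hx k hk).trans (by linarith)) hlow N
      (zero_add N) hε hε1
    simp only [nonpos_iff_eq_zero, forall_eq, norm_iteratedFDeriv_zero, Real.norm_eq_abs] at hmain
    refine hmain.trans (ENNReal.ofReal_le_ofReal ?_)
    exact mul_le_mul_of_nonneg_right (le_add_of_nonneg_right zero_le_one) (by positivity)
  · refine (measure_mono (t := Set.Icc (0 : Fin 2 → ℝ) 1) fun y hy => hy.1).trans ?_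
    rw [Real.volume_Icc_pi]
    simp only [Pi.one_apply, Pi.zero_apply, sub_zero, ENNReal.ofReal_one, Finset.prod_const_one,
      ENNReal.one_le_ofReal]
    refine one_le_mul_of_one_le_of_one_le (le_add_of_nonneg_left (by positivity))
      (Real.one_le_rpow hε1.le (by positivity))
end

section
/- Let $U \subseteq \mathbb{R}^2$ be a nonempty open set and $\varphi \in C^\infty(U)$ with $\partial \varphi/\partial x_1$ and $\partial \varphi/\partial x_2$ nowhere vanishing on $U$. Suppose that the ratio $(\partial\varphi/\partial x_1)/(\partial\varphi/\partial x_2)$ cannot be written on any nonempty open subset of $U$ as a product $a(x_1) b(x_2)$ of a smooth function of $x_1$ alone and a smooth function of $x_2$ alone. Then the phase $\phi(x_1,x_2,x_3) = x_3 \varphi(x_1,x_2)$ is not rank one degenerate on any open subset of $U \times (\mathbb{R} \setminus \{0\})$; that is, there exist no smooth hypersurface $H \subset U \times (\mathbb{R}\setminus\{0\})$ and smooth functions $h_1, h_2, h_3$ of one variable such that $\nabla(\phi(\mathbf{x}) - h_1(x_1) - h_2(x_2) - h_3(x_3))$ vanishes identically on $H$. -/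
/-- Near a point where it does not vanish, the inverse of a smooth function agrees with a globally
smooth function. -/
theorem exists_contDiff_eventually_mul_eq_one {g : ℝ → ℝ} (hg : ContDiff ℝ (⊤ : ℕ∞) g) {y : ℝ}
    (hy : g y ≠ 0) : ∃ b : ℝ → ℝ, ContDiff ℝ (⊤ : ℕ∞) b ∧ ∀ᶠ x in nhds y, b x * g x = 1 := by
  have hev : ∀ᶠ x in nhds y, g x ≠ 0 := hg.continuous.continuousAt.eventually_ne hy
  obtain ⟨r, hr, hball⟩ := Metric.nhds_basis_closedBall.mem_iff.1 hev
  let χ : ContDiffBump y := ⟨r / 2, r, half_pos hr, half_lt_self hr⟩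
  refine ⟨fun x => χ x / g x,
    contMDiff_iff_contDiff.1 (contMDiff_of_tsupport fun x hx => ?_), ?_⟩
  · have hx' : x ∈ Metric.closedBall y r := by
      have hsub : tsupport (fun x => χ x / g x) ⊆ tsupport χ :=
        closure_mono fun z hz hχ => hz (by simp [hχ])
      simpa [χ.tsupport_eq] using hsub hx
    exact (χ.contDiff.contDiffAt.div hg.contDiffAt (hball hx')).contMDiffAt
  · filter_upwards [hev, χ.eventuallyEq_one] with x hx hχ
    simp [hχ, hx]

/-- If the derivative of `G` in the last variable does not vanish at a zero of `G`, then the zero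
set of `G` projects onto a neighbourhood. -/
theorem eventually_exists_zero_of_fderiv_ne_zero {W : Set ((ℝ × ℝ) × ℝ)} {G : (ℝ × ℝ) × ℝ → ℝ}
    {p : (ℝ × ℝ) × ℝ} {G' : (ℝ × ℝ) × ℝ →L[ℝ] ℝ} (hW : W ∈ nhds p) (hG : HasStrictFDerivAt G G' p)
    (hp : G p = 0) (ht : G' (0, 1) ≠ 0) :
    ∀ᶠ q in nhds p.1, ∃ t, (q, t) ∈ W ∧ G (q, t) = 0 := by
  have hF : HasStrictFDerivAt (fun z : (ℝ × ℝ) × ℝ => (z.1, G z))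
      ((ContinuousLinearMap.fst ℝ (ℝ × ℝ) ℝ).prod G') p := hasStrictFDerivAt_fst.prodMk hG
  have hsurj : ((ContinuousLinearMap.fst ℝ (ℝ × ℝ) ℝ).prod G').range = ⊤ := by
    refine LinearMap.range_eq_top.2 fun ⟨v, s⟩ =>
      ⟨(v, (s - G' (v, 0)) / G' (0, 1)), Prod.ext rfl ?_⟩
    have hsplit : ∀ c : ℝ, G' (v, c) = G' (v, 0) + c * G' (0, 1) := fun c => by
      rw [← smul_eq_mul, ← map_smul, ← map_add]
      simp
    change G' (v, _) = s
    rw [hsplit]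
    field_simp
    ring
  have himage := Filter.image_mem_map (m := fun z : (ℝ × ℝ) × ℝ => (z.1, G z)) hW
  rw [hF.map_nhds_eq_of_surj hsurj, hp] at himage
  have hcont : Filter.Tendsto (fun q : ℝ × ℝ => (q, (0 : ℝ))) (nhds p.1) (nhds (p.1, 0)) :=
    (Continuous.prodMk_left (0 : ℝ)).tendsto p.1
  filter_upwards [hcont himage] with q hq
  obtain ⟨⟨q', t⟩, hz, hzq⟩ := hq
  obtain ⟨rfl, hGz⟩ := Prod.mk.inj hzq
  exact ⟨t, hz, hGz⟩

/-- A function that vanishes on a regular level set has, at each of its points, a differential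
that vanishes on the kernel of the differential of the defining function. -/
theorem apply_eq_zero_of_eventually_eq_zero_on_zeros {E : Type*} [NormedAddCommGroup E]
    [NormedSpace ℝ E] [CompleteSpace E] {f G : E → ℝ} {f' G' : E →L[ℝ] ℝ} {p v : E}
    (hf : HasStrictFDerivAt f f' p) (hG : HasStrictFDerivAt G G' p) (hp : G p = 0) (hG' : G' ≠ 0)
    (hzero : ∀ᶠ z in nhds p, G z = 0 → f z = 0) (hv : G' v = 0) : f' v = 0 := by
  have hfp : f p = 0 := hzero.self_of_nhds hp
  have hext : IsLocalExtrOn f {z | G z = G p} p := by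
    refine Or.inl (Filter.eventually_inf_principal.2 ?_)
    filter_upwards [hzero] with z hz hGz
    exact (hfp.trans (hz (Eq.trans hGz hp)).symm).le
  obtain ⟨a, b, hab, hsum⟩ := hext.exists_multipliers_of_hasStrictFDerivAt_1d hG hf
  have hbv : b * f' v = 0 := by simpa [hv] using DFunLike.congr_fun hsum v
  refine (mul_eq_zero.1 hbv).resolve_left fun hb => hab ?_
  have ha : a • G' = 0 := by simpa [hb] using hsum
  simp [(smul_eq_zero.1 ha).resolve_right hG', hb]

theorem stmt11 (U : Set (ℝ × ℝ)) (hU : IsOpen U) (hne : U.Nonempty)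
    (varphi : ℝ × ℝ → ℝ) (hsm : ContDiffOn ℝ (⊤ : ℕ∞) varphi U)
    (hp1 : ∀ q ∈ U, deriv (fun t => varphi (t, q.2)) q.1 ≠ 0)
    (hp2 : ∀ q ∈ U, deriv (fun t => varphi (q.1, t)) q.2 ≠ 0)
    (hfact : ¬ ∃ (W : Set (ℝ × ℝ)) (a b : ℝ → ℝ), IsOpen W ∧ W.Nonempty ∧ W ⊆ U ∧
      ContDiff ℝ (⊤ : ℕ∞) a ∧ ContDiff ℝ (⊤ : ℕ∞) b ∧
      ∀ q ∈ W, deriv (fun t => varphi (t, q.2)) q.1 =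
        a q.1 * b q.2 * deriv (fun t => varphi (q.1, t)) q.2) :
    ¬ ∃ (W : Set ((ℝ × ℝ) × ℝ)) (G : (ℝ × ℝ) × ℝ → ℝ) (h₁ h₂ h₃ : ℝ → ℝ),
      IsOpen W ∧ W ⊆ U ×ˢ {t : ℝ | t ≠ 0} ∧
      ContDiffOn ℝ (⊤ : ℕ∞) G W ∧
      ContDiff ℝ (⊤ : ℕ∞) h₁ ∧ ContDiff ℝ (⊤ : ℕ∞) h₂ ∧ ContDiff ℝ (⊤ : ℕ∞) h₃ ∧
      ({p ∈ W | G p = 0}).Nonempty ∧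
      (∀ p ∈ W, G p = 0 → fderiv ℝ G p ≠ 0) ∧
      (∀ p ∈ W, G p = 0 →
        p.2 * deriv (fun t => varphi (t, p.1.2)) p.1.1 = deriv h₁ p.1.1 ∧
        p.2 * deriv (fun t => varphi (p.1.1, t)) p.1.2 = deriv h₂ p.1.2 ∧
        varphi p.1 = deriv h₃ p.2) := by
  rintro ⟨W, G, h₁, h₂, h₃, hW, hWU, hG, hh₁, hh₂, -, ⟨p, hpW, hp⟩, hreg, hgrad⟩
  have hd₁ : ContDiff ℝ (⊤ : ℕ∞) (deriv h₁) := (contDiff_infty_iff_deriv.1 hh₁).2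
  have hd₂ : ContDiff ℝ (⊤ : ℕ∞) (deriv h₂) := (contDiff_infty_iff_deriv.1 hh₂).2
  have hWp : W ∈ nhds p := hW.mem_nhds hpW
  have hpU : p.1 ∈ U := (hWU hpW).1
  have hGs : HasStrictFDerivAt G (fderiv ℝ G p) p :=
    (hG.contDiffAt hWp).hasStrictFDerivAt (by simp)
  have hpartial : ∀ q ∈ U, deriv (fun t => varphi (t, q.2)) q.1 = fderiv ℝ varphi q (1, 0) := by
    intro q hq
    have hφ : HasFDerivAt varphi (fderiv ℝ varphi q) (q.1, q.2) :=
      ((hsm.contDiffAt (hU.mem_nhds hq)).differentiableAt (by simp)).hasFDerivAt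
    exact (hφ.comp_hasDerivAt q.1 ((hasDerivAt_id q.1).prodMk (hasDerivAt_const q.1 q.2))).deriv
  have ht : fderiv ℝ G p (0, 1) ≠ 0 := by
    intro hker
    let f : (ℝ × ℝ) × ℝ → ℝ := fun z => z.2 * fderiv ℝ varphi z.1 (1, 0) - deriv h₁ z.1.1
    have hφ' : ContDiffAt ℝ (⊤ : ℕ∞) (fderiv ℝ varphi) p.1 :=
      (hsm.contDiffAt (hU.mem_nhds hpU)).fderiv_right (by simp)
    have hf : ContDiffAt ℝ (⊤ : ℕ∞) f p :=
      (contDiffAt_snd.mul ((hφ'.comp p contDiffAt_fst).clm_apply contDiffAt_const)).sub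
        (hd₁.contDiffAt.comp p (contDiffAt_fst.comp p contDiffAt_fst))
    have hfs : HasStrictFDerivAt f (fderiv ℝ f p) p := hf.hasStrictFDerivAt (by simp)
    have hzero : ∀ᶠ z in nhds p, G z = 0 → f z = 0 := by
      filter_upwards [hWp] with z hz hGz
      simp only [f]
      rw [← hpartial z.1 (hWU hz).1, (hgrad z hz hGz).1, sub_self]
    have hf0 := apply_eq_zero_of_eventually_eq_zero_on_zeros hfs hGs hp (hreg p hpW hp) hzero hker
    have hfp : HasFDerivAt f (fderiv ℝ f p) (p.1, p.2) := hfs.hasFDerivAt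
    have hline := hfp.comp_hasDerivAt p.2 ((hasDerivAt_const p.2 p.1).prodMk (hasDerivAt_id p.2))
    have hline' : HasDerivAt (fun s => f (p.1, s)) (1 * fderiv ℝ varphi p.1 (1, 0)) p.2 :=
      ((hasDerivAt_id' p.2).mul_const (fderiv ℝ varphi p.1 (1, 0))).sub_const (deriv h₁ p.1.1)
    have hφ0 := hline'.unique hline
    rw [hf0, one_mul, ← hpartial p.1 hpU] at hφ0
    exact hp1 p.1 hpU hφ0
  have hh₂p : deriv h₂ p.1.2 ≠ 0 := by
    rw [← (hgrad p hpW hp).2.1]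
    exact mul_ne_zero (hWU hpW).2 (hp2 p.1 hpU)
  obtain ⟨b, hb, hbev⟩ := exists_contDiff_eventually_mul_eq_one hd₂ hh₂p
  obtain ⟨V, hV, hVo, hpV⟩ := eventually_nhds_iff.1
    ((eventually_exists_zero_of_fderiv_ne_zero hWp hGs hp ht).and
      (continuous_snd.continuousAt.eventually hbev))
  refine hfact ⟨V, deriv h₁, b, hVo, ⟨p.1, hpV⟩, fun q hq => ?_, hd₁, hb, fun q hq => ?_⟩
  · obtain ⟨⟨t, hqt, -⟩, -⟩ := hV q hq
    exact (hWU hqt).1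
  · obtain ⟨⟨t, hqt, hGt⟩, hbq⟩ := hV q hq
    obtain ⟨e₁, e₂, -⟩ := hgrad _ hqt hGt
    rw [← e₂] at hbq
    rw [← e₁]
    linear_combination -deriv (fun t => varphi (t, q.2)) q.1 * hbq
end
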